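/- arXiv:2406.16662 — 2 statements merged into one kernel-verified Lean document; each statement's English description precedes it below -/
import Mathlib

section
/- Resolvability lemma: Let 𝒳1, 𝒳2, 𝒵 be finite sets, W(z|x1,x2) a channel (a PMF on 𝒵 for each (x1,x2)), P_1, P_2 PMFs on 𝒳1, 𝒳2, and L_1, L_2 ≥ 1 integers. Let the codebook 𝒞 consist of random codewords X_{1,1},…,X_{1,L_1} drawn i.i.d. from P_1 and X_{2,1},…,X_{2,L_2} drawn i.i.d. from P_2, all mutually independent, and define P_{Z|𝒞}(z) := (1/(L_1 L_2)) Σ_{j_1=1}^{L_1} Σ_{j_2=1}^{L_2} W(z | X_{1,j_1}, X_{2,j_2}), and P_Z(z) := Σ_{x_1,x_2} P_1(x_1) P_2(x_2) W(z|x_1,x_2). Then for every s ∈ [0,1]: s · E_𝒞[ D_{1+s}(P_{Z|𝒞} ‖ P_Z) ] ≤ L_1^{−s} e^{s·I↑_{1+s}(Z;X_1)} + L_2^{−s} e^{s·I↑_{1+s}(Z;X_2)} + (L_1 L_2)^{−s} e^{s·I↑_{1+s}(Z;X_1,X_2)}. -/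
open Finset

/-- Rényi divergence of order `α` between two probability mass functions on a finite set,
with natural logarithm. -/
noncomputable def renyiDiv {Ω : Type*} [Fintype Ω] (α : ℝ) (P Q : Ω → ℝ) : ℝ :=
  (α - 1)⁻¹ * Real.log (∑ ω ∈ Finset.univ.filter (fun ω => 0 < P ω), P ω ^ α * Q ω ^ (1 - α))

theorem sum_prod_mul_apply {ι X : Type*} [Fintype ι] [DecidableEq ι] [Fintype X]
    {P : X → ℝ} (hP : ∑ x, P x = 1) (j : ι) (g : X → ℝ) :
    ∑ c : ι → X, (∏ i, P (c i)) * g (c j) = ∑ x, P x * g x := by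
  have h (c : ι → X) : (∏ i, P (c i)) * g (c j) =
      ∏ i, P (c i) * (if i = j then g (c i) else 1) := by
    rw [prod_mul_distrib]
    simp
  simp_rw [h]
  rw [← Fintype.prod_sum (fun i x => P x * (if i = j then g x else 1)), Fintype.prod_eq_single j]
  · simp
  · intro i hi
    simp [hi, hP]

theorem sum_prod_mul_apply_mul_apply {ι X : Type*} [Fintype ι] [DecidableEq ι] [Fintype X]
    {P : X → ℝ} (hP : ∑ x, P x = 1) {j k : ι} (hjk : j ≠ k) (g h : X → ℝ) :
    ∑ c : ι → X, (∏ i, P (c i)) * (g (c j) * h (c k)) =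
      (∑ x, P x * g x) * ∑ x, P x * h x := by
  have e (c : ι → X) : (∏ i, P (c i)) * (g (c j) * h (c k)) =
      ∏ i, P (c i) * ((if i = j then g (c i) else 1) * (if i = k then h (c i) else 1)) := by
    rw [prod_mul_distrib, prod_mul_distrib]
    simp
  simp_rw [e]
  rw [← Fintype.prod_sum
    (fun i x => P x * ((if i = j then g x else 1) * (if i = k then h x else 1))),
    Fintype.prod_eq_mul j k hjk]
  · simp [hjk, hjk.symm]
  · rintro i ⟨hi, hi'⟩
    simp [hi, hi', hP]

theorem sum_prod_mul_apply₂ {ι X : Type*} [Fintype ι] [DecidableEq ι] [Fintype X]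
    {P : X → ℝ} (hP : ∑ x, P x = 1) {j k : ι} (hjk : j ≠ k) (G : X → X → ℝ) :
    ∑ c : ι → X, (∏ i, P (c i)) * G (c j) (c k) = ∑ x, P x * ∑ y, P y * G x y := by
  classical
  have e (c : ι → X) : (∏ i, P (c i)) * G (c j) (c k) =
      ∑ x, (∏ i, P (c i)) * ((if c j = x then 1 else 0) * G x (c k)) := by
    simp
  simp_rw [e]
  rw [sum_comm]
  refine sum_congr rfl fun x _ => ?_
  rw [sum_prod_mul_apply_mul_apply hP hjk (fun y => if y = x then 1 else 0) (G x)]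
  simp

/-- For i.i.d. codewords, the expected sum over `k` of a nonnegative function of the `j`-th and
`k`-th codewords is at most its diagonal term plus `card ι` independent terms. -/
theorem sum_prod_mul_sum_apply₂_le {ι X : Type*} [Fintype ι] [DecidableEq ι] [Fintype X]
    {P : X → ℝ} (hP0 : ∀ x, 0 ≤ P x) (hP : ∑ x, P x = 1)
    (j : ι) (G : X → X → ℝ) (hG : ∀ x y, 0 ≤ G x y) :
    ∑ c : ι → X, (∏ i, P (c i)) * ∑ k, G (c j) (c k) ≤
      ∑ x, P x * (G x x + Fintype.card ι * ∑ y, P y * G x y) := by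
  simp_rw [mul_sum (s := (univ : Finset ι)), mul_add, sum_add_distrib]
  rw [sum_comm, ← add_sum_erase univ _ (mem_univ j)]
  rw [sum_prod_mul_apply hP j (fun x => G x x)]
  gcongr
  rw [sum_congr rfl fun k hk => sum_prod_mul_apply₂ hP (ne_of_mem_erase hk).symm G]
  have h0 : 0 ≤ ∑ x, P x * ∑ y, P y * G x y :=
    sum_nonneg fun x _ => mul_nonneg (hP0 x) (sum_nonneg fun y _ => mul_nonneg (hP0 y) (hG x y))
  calc _ ≤ ∑ k : ι, ∑ x, P x * ∑ y, P y * G x y :=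
        sum_le_sum_of_subset_of_nonneg (erase_subset _ _) fun _ _ _ => h0
    _ = _ := by
      simp only [sum_const, card_univ, nsmul_eq_mul, mul_sum]
      refine sum_congr rfl fun x _ => sum_congr rfl fun y _ => by ring

theorem sum_prod_mul_sum_sum_le {X1 X2 : Type*} [Fintype X1] [Fintype X2]
    {P1 : X1 → ℝ} (hP10 : ∀ x, 0 ≤ P1 x) (hP11 : ∑ x, P1 x = 1)
    {P2 : X2 → ℝ} (hP20 : ∀ x, 0 ≤ P2 x) (hP21 : ∑ x, P2 x = 1)
    {L1 L2 : ℕ} (j1 : Fin L1) (j2 : Fin L2) {f V : X1 → X2 → ℝ}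
    (hf : ∀ x u, 0 ≤ f x u) (hV : ∀ x u, 0 ≤ V x u) :
    ∑ c1 : Fin L1 → X1, ∑ c2 : Fin L2 → X2, ((∏ j, P1 (c1 j)) * ∏ j, P2 (c2 j)) *
        (f (c1 j1) (c2 j2) * ∑ k1, ∑ k2, V (c1 k1) (c2 k2)) ≤
      ∑ x, P1 x * ∑ u, P2 u * (f x u * (V x u + L2 * ∑ v, P2 v * V x v +
        L1 * ∑ y, P1 y * V y u + L1 * L2 * ∑ y, ∑ v, P1 y * P2 v * V y v)) := by
  set H : X1 → X1 → ℝ := fun x y =>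
    ∑ c2 : Fin L2 → X2, (∏ j, P2 (c2 j)) * ∑ k2, f x (c2 j2) * V y (c2 k2) with hH
  have hH0 (x y) : 0 ≤ H x y :=
    sum_nonneg fun c _ => mul_nonneg (prod_nonneg fun _ _ => hP20 _)
      (sum_nonneg fun _ _ => mul_nonneg (hf _ _) (hV _ _))
  have hHle (x y) : H x y ≤ ∑ u, P2 u * (f x u * V y u + L2 * ∑ v, P2 v * (f x u * V y v)) := by
    simpa using sum_prod_mul_sum_apply₂_le hP20 hP21 j2 (fun u v => f x u * V y v)
      fun u v => mul_nonneg (hf _ _) (hV _ _)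
  calc _ = ∑ c1 : Fin L1 → X1, (∏ j, P1 (c1 j)) * ∑ k1, H (c1 j1) (c1 k1) := by
        refine sum_congr rfl fun c1 _ => ?_
        simp_rw [hH, mul_sum]
        rw [sum_comm]
        refine sum_congr rfl fun k1 _ => sum_congr rfl fun c2 _ => sum_congr rfl fun k2 _ => by ring
    _ ≤ ∑ x, P1 x * (H x x + L1 * ∑ y, P1 y * H x y) := by
        simpa using sum_prod_mul_sum_apply₂_le hP10 hP11 j1 H hH0
    _ ≤ ∑ x, P1 x * ((∑ u, P2 u * (f x u * V x u + L2 * ∑ v, P2 v * (f x u * V x v))) +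
          L1 * ∑ y, P1 y *
            ∑ u, P2 u * (f x u * V y u + L2 * ∑ v, P2 v * (f x u * V y v))) := by
        gcongr with x _ y _
        · exact hP10 x
        · exact hHle x x
        · exact hP10 y
        · exact hHle x y
    _ = _ := by
        refine sum_congr rfl fun x _ => ?_
        congr 1
        simp only [mul_add, sum_add_distrib, add_assoc]
        congr 1
        congr 1
        · simp_rw [mul_sum]
          refine sum_congr rfl fun u _ => sum_congr rfl fun v _ => by ring
        congr 1
        · simp_rw [mul_sum]
          rw [sum_comm]
          refine sum_congr rfl fun u _ => sum_congr rfl fun v _ => by ring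
        · simp_rw [mul_sum]
          rw [sum_comm]
          refine sum_congr rfl fun u _ => sum_congr rfl fun v _ => sum_congr rfl fun w _ => by ring

theorem Real.rpow_le_rpow_add_tangent {s t m : ℝ} (hs0 : 0 ≤ s) (hs1 : s ≤ 1) (ht : 0 ≤ t)
    (hm : 0 < m) : t ^ s ≤ m ^ s + s * m ^ (s - 1) * (t - m) := by
  have h := _root_.rpow_one_add_le_one_add_mul_self (s := t / m - 1) (p := s)
    (by linarith [div_nonneg ht hm.le]) hs0 hs1
  rw [add_sub_cancel, Real.div_rpow ht hm.le, div_le_iff₀ (by positivity)] at h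
  rw [Real.rpow_sub_one hm.ne']
  calc _ ≤ _ := h
    _ = _ := by field_simp

theorem sum_prod_mul_rpow_one_add_le {X1 X2 : Type*} [Fintype X1] [Fintype X2]
    {P1 : X1 → ℝ} (hP10 : ∀ x, 0 ≤ P1 x) (hP11 : ∑ x, P1 x = 1)
    {P2 : X2 → ℝ} (hP20 : ∀ x, 0 ≤ P2 x) (hP21 : ∑ x, P2 x = 1)
    {L1 L2 : ℕ} (hL1 : 1 ≤ L1) (hL2 : 1 ≤ L2) {V : X1 → X2 → ℝ} (hV : ∀ x u, 0 ≤ V x u)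
    {s : ℝ} (hs0 : 0 ≤ s) (hs1 : s ≤ 1) {M : X1 → X2 → ℝ}
    (hM : ∀ x u, M x u = ((L1 : ℝ) * L2)⁻¹ * V x u + (L1 : ℝ)⁻¹ * ∑ v, P2 v * V x v +
      (L2 : ℝ)⁻¹ * ∑ y, P1 y * V y u + ∑ y, ∑ v, P1 y * P2 v * V y v)
    (hM0 : ∀ x u, 0 < M x u) :
    ∑ c1 : Fin L1 → X1, ∑ c2 : Fin L2 → X2, ((∏ j, P1 (c1 j)) * ∏ j, P2 (c2 j)) *
        ((1 / ((L1 : ℝ) * L2)) * ∑ k1, ∑ k2, V (c1 k1) (c2 k2)) ^ (1 + s) ≤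
      ∑ x, P1 x * ∑ u, P2 u * (V x u * M x u ^ s) := by
  have hL1' : (0 : ℝ) < L1 := by exact_mod_cast hL1
  have hL2' : (0 : ℝ) < L2 := by exact_mod_cast hL2
  set w : (Fin L1 → X1) → (Fin L2 → X2) → ℝ := fun c1 c2 =>
    (∏ j, P1 (c1 j)) * ∏ j, P2 (c2 j) with hw
  have hw0 (c1 c2) : 0 ≤ w c1 c2 :=
    mul_nonneg (prod_nonneg fun _ _ => hP10 _) (prod_nonneg fun _ _ => hP20 _)
  set T : (Fin L1 → X1) → (Fin L2 → X2) → ℝ := fun c1 c2 =>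
    (1 / ((L1 : ℝ) * L2)) * ∑ k1, ∑ k2, V (c1 k1) (c2 k2) with hT
  have hT0 (c1 c2) : 0 ≤ T c1 c2 :=
    mul_nonneg (by positivity) (sum_nonneg fun _ _ => sum_nonneg fun _ _ => hV _ _)
  set R := ∑ x, P1 x * ∑ u, P2 u * (V x u * M x u ^ s) with hR
  set f : X1 → X2 → ℝ := fun x u => V x u * (s * M x u ^ (s - 1)) with hf
  have hf0 (x u) : 0 ≤ f x u :=
    mul_nonneg (hV _ _) (mul_nonneg hs0 (Real.rpow_nonneg (hM0 x u).le _))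
  have marg (g : X1 → X2 → ℝ) (j1 : Fin L1) (j2 : Fin L2) :
      ∑ c1, ∑ c2, w c1 c2 * g (c1 j1) (c2 j2) = ∑ x, P1 x * ∑ u, P2 u * g x u := by
    rw [← sum_prod_mul_apply hP11 j1]
    refine sum_congr rfl fun c1 _ => ?_
    rw [← sum_prod_mul_apply hP21 j2, mul_sum]
    refine sum_congr rfl fun c2 _ => ?_
    rw [hw, mul_assoc]
  have hfT (j1 : Fin L1) (j2 : Fin L2) :
      ∑ c1, ∑ c2, w c1 c2 * (f (c1 j1) (c2 j2) * T c1 c2) ≤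
        ∑ x, P1 x * ∑ u, P2 u * (f x u * M x u) := by
    have h := mul_le_mul_of_nonneg_left
      (sum_prod_mul_sum_sum_le hP10 hP11 hP20 hP21 j1 j2 hf0 hV)
      (show 0 ≤ 1 / ((L1 : ℝ) * L2) by positivity)
    refine le_of_eq_of_le ?_ (h.trans_eq ?_)
    · simp_rw [mul_sum (s := (univ : Finset (Fin L1 → X1))),
        mul_sum (s := (univ : Finset (Fin L2 → X2)))]
      refine sum_congr rfl fun c1 _ => sum_congr rfl fun c2 _ => ?_
      simp only [hT, hw]
      ring
    · simp_rw [mul_sum (s := (univ : Finset X1)) _ (1 / ((L1 : ℝ) * L2))]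
      refine sum_congr rfl fun x _ => ?_
      rw [mul_left_comm, mul_sum]
      congr 1
      refine sum_congr rfl fun u _ => ?_
      rw [hM]
      field_simp
  have hpt (j1 : Fin L1) (j2 : Fin L2) :
      ∑ c1, ∑ c2, w c1 c2 * (V (c1 j1) (c2 j2) * T c1 c2 ^ s) ≤ R := by
    have h1 : ∑ c1, ∑ c2, w c1 c2 * (V (c1 j1) (c2 j2) * T c1 c2 ^ s) ≤
        ∑ c1, ∑ c2, (w c1 c2 * (V (c1 j1) (c2 j2) * M (c1 j1) (c2 j2) ^ s) +
          w c1 c2 * (f (c1 j1) (c2 j2) * T c1 c2) -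
          w c1 c2 * (f (c1 j1) (c2 j2) * M (c1 j1) (c2 j2))) := by
      refine sum_le_sum fun c1 _ => sum_le_sum fun c2 _ => ?_
      have := mul_le_mul_of_nonneg_left (mul_le_mul_of_nonneg_left
        (Real.rpow_le_rpow_add_tangent hs0 hs1 (hT0 c1 c2) (hM0 (c1 j1) (c2 j2)))
        (hV (c1 j1) (c2 j2))) (hw0 c1 c2)
      refine this.trans_eq ?_
      simp only [hf]
      ring
    simp_rw [sum_sub_distrib, sum_add_distrib] at h1
    rw [marg (fun x u => V x u * M x u ^ s), marg (fun x u => f x u * M x u)] at h1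
    linarith [hfT j1 j2]
  calc ∑ c1, ∑ c2, w c1 c2 * T c1 c2 ^ (1 + s)
    _ = (1 / ((L1 : ℝ) * L2)) * ∑ j1, ∑ j2, ∑ c1, ∑ c2,
          w c1 c2 * (V (c1 j1) (c2 j2) * T c1 c2 ^ s) := by
        have e (c1 c2) : w c1 c2 * T c1 c2 ^ (1 + s) = (1 / ((L1 : ℝ) * L2)) *
            ∑ j1, ∑ j2, w c1 c2 * (V (c1 j1) (c2 j2) * T c1 c2 ^ s) := by
          rw [Real.rpow_one_add' (hT0 c1 c2) (by linarith)]
          nth_rw 1 [hT]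
          simp_rw [← mul_sum, ← sum_mul]
          ring
        simp_rw [e, ← mul_sum _ _ (1 / ((L1 : ℝ) * L2))]
        congr 1
        rw [sum_congr rfl fun c1 _ => sum_comm, sum_comm]
        refine sum_congr rfl fun j1 _ => ?_
        rw [sum_congr rfl fun c1 _ => sum_comm, sum_comm]
    _ ≤ (1 / ((L1 : ℝ) * L2)) * ∑ j1 : Fin L1, ∑ j2 : Fin L2, R := by
        gcongr with j1 _ j2 _
        exact hpt j1 j2
    _ = R := by
        simp only [sum_const, card_univ, Fintype.card_fin, nsmul_eq_mul]
        field_simp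

theorem sum_prod_mul_rpow_one_add_le_add {X1 X2 : Type*} [Fintype X1] [Fintype X2]
    {P1 : X1 → ℝ} (hP10 : ∀ x, 0 ≤ P1 x) (hP11 : ∑ x, P1 x = 1)
    {P2 : X2 → ℝ} (hP20 : ∀ x, 0 ≤ P2 x) (hP21 : ∑ x, P2 x = 1)
    {L1 L2 : ℕ} (hL1 : 1 ≤ L1) (hL2 : 1 ≤ L2) {V : X1 → X2 → ℝ} (hV : ∀ x u, 0 ≤ V x u)
    {s : ℝ} (hs0 : 0 ≤ s) (hs1 : s ≤ 1) {q : ℝ} (hq : q = ∑ y, ∑ v, P1 y * P2 v * V y v)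
    (hq0 : 0 < q) :
    ∑ c1 : Fin L1 → X1, ∑ c2 : Fin L2 → X2, ((∏ j, P1 (c1 j)) * ∏ j, P2 (c2 j)) *
        ((1 / ((L1 : ℝ) * L2)) * ∑ k1, ∑ k2, V (c1 k1) (c2 k2)) ^ (1 + s) ≤
      ((L1 : ℝ) * L2) ^ (-s) * ∑ x, ∑ u, P1 x * P2 u * V x u ^ (1 + s) +
      (L1 : ℝ) ^ (-s) * ∑ x, P1 x * (∑ u, P2 u * V x u) ^ (1 + s) +
      (L2 : ℝ) ^ (-s) * ∑ u, P2 u * (∑ x, P1 x * V x u) ^ (1 + s) +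
      q ^ (1 + s) := by
  have hL1' : (0 : ℝ) < L1 := by exact_mod_cast hL1
  have hL2' : (0 : ℝ) < L2 := by exact_mod_cast hL2
  set A : X1 → ℝ := fun x => ∑ v, P2 v * V x v with hA
  set B : X2 → ℝ := fun u => ∑ y, P1 y * V y u with hB
  have hA0 (x) : 0 ≤ A x := sum_nonneg fun _ _ => mul_nonneg (hP20 _) (hV _ _)
  have hB0 (x) : 0 ≤ B x := sum_nonneg fun _ _ => mul_nonneg (hP10 _) (hV _ _)
  have hs' : 1 + s ≠ 0 := by linarith
  refine (sum_prod_mul_rpow_one_add_le hP10 hP11 hP20 hP21 hL1 hL2 hV hs0 hs1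
    (M := fun x u => ((L1 : ℝ) * L2)⁻¹ * V x u + (L1 : ℝ)⁻¹ * A x + (L2 : ℝ)⁻¹ * B u + q)
    (fun x u => by rw [hq]) (fun x u => ?_)).trans ?_
  · have := hV x u
    have := hA0 x
    have := hB0 u
    positivity
  have key (x u) : (((L1 : ℝ) * L2)⁻¹ * V x u + (L1 : ℝ)⁻¹ * A x + (L2 : ℝ)⁻¹ * B u + q) ^ s ≤
      ((L1 : ℝ) * L2) ^ (-s) * V x u ^ s + (L1 : ℝ) ^ (-s) * A x ^ s +
        (L2 : ℝ) ^ (-s) * B u ^ s + q ^ s := by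
    have h0 : 0 ≤ ((L1 : ℝ) * L2)⁻¹ * V x u := mul_nonneg (by positivity) (hV x u)
    have h1 : 0 ≤ (L1 : ℝ)⁻¹ * A x := mul_nonneg (by positivity) (hA0 x)
    have h2 : 0 ≤ (L2 : ℝ)⁻¹ * B u := mul_nonneg (by positivity) (hB0 u)
    have e {a b : ℝ} (ha : 0 < a) (hb : 0 ≤ b) : (a⁻¹ * b) ^ s = a ^ (-s) * b ^ s := by
      rw [Real.mul_rpow (by positivity) hb, Real.inv_rpow ha.le, Real.rpow_neg ha.le]
    rw [← e (by positivity) (hV x u), ← e hL1' (hA0 x), ← e hL2' (hB0 u)]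
    have i1 := Real.rpow_add_le_add_rpow (add_nonneg (add_nonneg h0 h1) h2) hq0.le hs0 hs1
    have i2 := Real.rpow_add_le_add_rpow (add_nonneg h0 h1) h2 hs0 hs1
    have i3 := Real.rpow_add_le_add_rpow h0 h1 hs0 hs1
    linarith
  calc _ ≤ ∑ x, P1 x * ∑ u, P2 u * (V x u * (((L1 : ℝ) * L2) ^ (-s) * V x u ^ s +
          (L1 : ℝ) ^ (-s) * A x ^ s + (L2 : ℝ) ^ (-s) * B u ^ s + q ^ s)) := by
        gcongr with x _ u _
        · exact hP10 x
        · exact hP20 u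
        · exact hV x u
        · exact key x u
    _ = _ := by
        simp_rw [mul_add, sum_add_distrib, mul_add, sum_add_distrib]
        congr 1
        congr 1
        congr 1
        · simp_rw [mul_sum]
          refine sum_congr rfl fun x _ => sum_congr rfl fun u _ => ?_
          rw [Real.rpow_one_add' (hV x u) hs']
          ring
        · rw [mul_sum]
          refine sum_congr rfl fun x _ => ?_
          rw [Real.rpow_one_add' (hA0 x) hs']
          nth_rw 2 [hA]
          simp_rw [sum_mul, mul_sum]
          refine sum_congr rfl fun u _ => by ring
        · simp_rw [mul_sum]
          rw [sum_comm]
          refine sum_congr rfl fun u _ => ?_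
          rw [Real.rpow_one_add' (hB0 u) hs']
          nth_rw 2 [hB]
          simp_rw [sum_mul, mul_sum]
          refine sum_congr rfl fun u _ => by ring
        · rw [Real.rpow_one_add' hq0.le hs']
          nth_rw 2 [hq]
          simp_rw [sum_mul, mul_sum]
          refine sum_congr rfl fun x _ => sum_congr rfl fun u _ => by ring

theorem mul_renyiDiv_one_add {Ω : Type*} [Fintype Ω] {s : ℝ} (hs : 0 < s) {P : Ω → ℝ}
    (hP : ∀ ω, 0 ≤ P ω) (Q : Ω → ℝ) :
    s * renyiDiv (1 + s) P Q = Real.log (∑ ω, P ω ^ (1 + s) * Q ω ^ (-s)) := by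
  have h : ∑ ω ∈ univ.filter (fun ω => 0 < P ω), P ω ^ (1 + s) * Q ω ^ (1 - (1 + s)) =
      ∑ ω, P ω ^ (1 + s) * Q ω ^ (-s) := by
    rw [show 1 - (1 + s) = -s by ring, sum_filter]
    refine sum_congr rfl fun ω _ => ?_
    split_ifs with h
    · rfl
    · rw [le_antisymm (not_lt.1 h) (hP ω), Real.zero_rpow (by linarith), zero_mul]
  rw [renyiDiv, h, add_sub_cancel_left, mul_inv_cancel_left₀ hs.ne']

theorem sum_rpow_mul_rpow_pos {Ω : Type*} [Fintype Ω] (a b : ℝ) {P Q : Ω → ℝ}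
    (hP : ∀ ω, 0 ≤ P ω) (hP1 : 0 < ∑ ω, P ω) (hQ : ∀ ω, 0 ≤ Q ω)
    (hPQ : ∀ ω, 0 < P ω → 0 < Q ω) : 0 < ∑ ω, P ω ^ a * Q ω ^ b := by
  obtain ⟨ω, -, hω⟩ := exists_lt_of_sum_lt (s := univ) (f := fun _ : Ω => (0 : ℝ)) (by simpa)
  exact sum_pos' (fun ω _ => mul_nonneg (Real.rpow_nonneg (hP ω) _) (Real.rpow_nonneg (hQ ω) _))
    ⟨ω, mem_univ _, mul_pos (Real.rpow_pos_of_pos hω _) (Real.rpow_pos_of_pos (hPQ ω hω) _)⟩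

theorem exp_mul_renyiDiv_one_add {Ω : Type*} [Fintype Ω] {s : ℝ} (hs : 0 < s) {P Q : Ω → ℝ}
    (hP : ∀ ω, 0 ≤ P ω) (hP1 : 0 < ∑ ω, P ω) (hQ : ∀ ω, 0 ≤ Q ω)
    (hPQ : ∀ ω, 0 < P ω → 0 < Q ω) :
    Real.exp (s * renyiDiv (1 + s) P Q) = ∑ ω, P ω ^ (1 + s) * Q ω ^ (-s) := by
  rw [mul_renyiDiv_one_add hs hP, Real.exp_log (sum_rpow_mul_rpow_pos _ _ hP hP1 hQ hPQ)]

theorem Real.mul_rpow_one_add_mul_mul_rpow_neg {s p w q : ℝ} (hs : 0 < s) (hp : 0 ≤ p)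
    (hw : 0 ≤ w) (hq : 0 ≤ q) :
    (p * w) ^ (1 + s) * (q * p) ^ (-s) = p * w ^ (1 + s) * q ^ (-s) := by
  rcases hp.eq_or_lt with rfl | hp
  · simp [Real.zero_rpow (show 1 + s ≠ 0 by linarith)]
  · rw [Real.mul_rpow hp.le hw, Real.mul_rpow hq hp.le, Real.rpow_add hp, Real.rpow_one,
      Real.rpow_neg hp.le]
    field_simp

/-- Resolvability lemma for the two-transmitter MAC: if the codebook `𝒞` consists of
`L1` i.i.d. codewords from `P1` and `L2` i.i.d. codewords from `P2`, then for `s ∈ [0,1]`,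
`s·E_𝒞[D_{1+s}(P_{Z|𝒞} ‖ P_Z)] ≤ L1^{−s} e^{s I↑_{1+s}(Z;X1)} + L2^{−s} e^{s I↑_{1+s}(Z;X2)}
  + (L1 L2)^{−s} e^{s I↑_{1+s}(Z;X1,X2)}`. -/
theorem resolvability_MAC {X1 X2 Z : Type*} [Fintype X1] [Fintype X2] [Fintype Z]
    (W : Z → X1 → X2 → ℝ) (hW0 : ∀ z x1 x2, 0 ≤ W z x1 x2)
    (hW1 : ∀ x1 x2, ∑ z, W z x1 x2 = 1)
    (P1 : X1 → ℝ) (hP10 : ∀ x, 0 ≤ P1 x) (hP11 : ∑ x, P1 x = 1)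
    (P2 : X2 → ℝ) (hP20 : ∀ x, 0 ≤ P2 x) (hP21 : ∑ x, P2 x = 1)
    (L1 L2 : ℕ) (hL1 : 1 ≤ L1) (hL2 : 1 ≤ L2)
    (s : ℝ) (hs : s ∈ Set.Icc (0 : ℝ) 1) :
    s * (∑ c1 : Fin L1 → X1, ∑ c2 : Fin L2 → X2,
      ((∏ j, P1 (c1 j)) * ∏ j, P2 (c2 j)) *
        renyiDiv (1 + s)
          (fun z => (1 / ((L1 : ℝ) * (L2 : ℝ))) * ∑ j1, ∑ j2, W z (c1 j1) (c2 j2))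
          (fun z => ∑ x1, ∑ x2, P1 x1 * P2 x2 * W z x1 x2)) ≤
      (L1 : ℝ) ^ (-s) * Real.exp (s *
        renyiDiv (1 + s)
          (fun p : Z × X1 => P1 p.2 * ∑ x2, P2 x2 * W p.1 p.2 x2)
          (fun p : Z × X1 => (∑ x1, ∑ x2, P1 x1 * P2 x2 * W p.1 x1 x2) * P1 p.2)) +
      (L2 : ℝ) ^ (-s) * Real.exp (s *
        renyiDiv (1 + s)
          (fun p : Z × X2 => P2 p.2 * ∑ x1, P1 x1 * W p.1 x1 p.2)
          (fun p : Z × X2 => (∑ x1, ∑ x2, P1 x1 * P2 x2 * W p.1 x1 x2) * P2 p.2)) +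
      ((L1 : ℝ) * (L2 : ℝ)) ^ (-s) * Real.exp (s *
        renyiDiv (1 + s)
          (fun p : Z × (X1 × X2) => P1 p.2.1 * P2 p.2.2 * W p.1 p.2.1 p.2.2)
          (fun p : Z × (X1 × X2) =>
            (∑ x1, ∑ x2, P1 x1 * P2 x2 * W p.1 x1 x2) * (P1 p.2.1 * P2 p.2.2))) := by
  obtain ⟨hs0, hs1⟩ := hs
  rcases hs0.eq_or_lt with rfl | hs
  · rw [zero_mul]
    positivity
  have hL1' : (0 : ℝ) < L1 := by exact_mod_cast hL1
  have hL2' : (0 : ℝ) < L2 := by exact_mod_cast hL2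
  set q : Z → ℝ := fun z => ∑ x1, ∑ x2, P1 x1 * P2 x2 * W z x1 x2 with hq
  set w : (Fin L1 → X1) → (Fin L2 → X2) → ℝ := fun c1 c2 =>
    (∏ j, P1 (c1 j)) * ∏ j, P2 (c2 j) with hw
  set T : (Fin L1 → X1) → (Fin L2 → X2) → Z → ℝ := fun c1 c2 z =>
    (1 / ((L1 : ℝ) * (L2 : ℝ))) * ∑ j1, ∑ j2, W z (c1 j1) (c2 j2) with hT
  have hw0 (c1 c2) : 0 ≤ w c1 c2 :=
    mul_nonneg (prod_nonneg fun _ _ => hP10 _) (prod_nonneg fun _ _ => hP20 _)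
  have hT0 (c1 c2 z) : 0 ≤ T c1 c2 z :=
    mul_nonneg (by positivity) (sum_nonneg fun _ _ => sum_nonneg fun _ _ => hW0 _ _ _)
  have hterm0 (z x1 x2) : 0 ≤ P1 x1 * P2 x2 * W z x1 x2 :=
    mul_nonneg (mul_nonneg (hP10 _) (hP20 _)) (hW0 _ _ _)
  have hq0 (z) : 0 ≤ q z := sum_nonneg fun _ _ => sum_nonneg fun _ _ => hterm0 _ _ _
  have hqpos (z x1 x2) (h1 : 0 < P1 x1) (h2 : 0 < P2 x2) (h3 : 0 < W z x1 x2) : 0 < q z :=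
    sum_pos' (fun _ _ => sum_nonneg fun _ _ => hterm0 _ _ _) ⟨x1, mem_univ _,
      sum_pos' (fun _ _ => hterm0 _ _ _) ⟨x2, mem_univ _, mul_pos (mul_pos h1 h2) h3⟩⟩
  have hA0 (z x1) : 0 ≤ ∑ x2, P2 x2 * W z x1 x2 :=
    sum_nonneg fun _ _ => mul_nonneg (hP20 _) (hW0 _ _ _)
  have hB0 (z x2) : 0 ≤ ∑ x1, P1 x1 * W z x1 x2 :=
    sum_nonneg fun _ _ => mul_nonneg (hP10 _) (hW0 _ _ _)
  have hqA (z) : q z = ∑ x1, P1 x1 * ∑ x2, P2 x2 * W z x1 x2 := by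
    simp only [hq, mul_sum, mul_assoc]
  have hqB (z) : q z = ∑ x2, P2 x2 * ∑ x1, P1 x1 * W z x1 x2 := by
    simp only [hq, mul_sum]
    rw [sum_comm]
    exact sum_congr rfl fun _ _ => sum_congr rfl fun _ _ => by ring
  have hqsum : ∑ z, q z = 1 := by
    simp only [hq]
    rw [sum_comm, sum_congr rfl fun _ _ => sum_comm]
    simp_rw [← mul_sum, hW1, mul_one, ← mul_sum, hP21, mul_one, hP11]
  have hTsum (c1 c2) : ∑ z, T c1 c2 z = 1 := by
    simp only [hT]
    rw [← mul_sum, sum_comm, sum_congr rfl fun _ _ => sum_comm]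
    simp only [hW1, sum_const, card_univ, Fintype.card_fin, nsmul_eq_mul, mul_one]
    field_simp
  have hwsum : ∑ c1, ∑ c2, w c1 c2 = 1 := by
    simp only [hw, ← mul_sum, ← sum_mul]
    rw [← Fintype.prod_sum fun (_ : Fin L1) x => P1 x,
      ← Fintype.prod_sum fun (_ : Fin L2) x => P2 x]
    simp [hP11, hP21]
  -- the three mutual-information terms
  have e1 : Real.exp (s * renyiDiv (1 + s)
      (fun p : Z × X1 => P1 p.2 * ∑ x2, P2 x2 * W p.1 p.2 x2)
      (fun p : Z × X1 => q p.1 * P1 p.2)) =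
      ∑ z, (∑ x1, P1 x1 * (∑ x2, P2 x2 * W z x1 x2) ^ (1 + s)) * q z ^ (-s) := by
    rw [exp_mul_renyiDiv_one_add hs (fun p => mul_nonneg (hP10 _) (hA0 _ _)) ?_
      (fun p => mul_nonneg (hq0 _) (hP10 _)) ?_, Fintype.sum_prod_type]
    · refine sum_congr rfl fun z _ => ?_
      rw [sum_mul]
      exact sum_congr rfl fun x _ =>
        Real.mul_rpow_one_add_mul_mul_rpow_neg hs (hP10 x) (hA0 z x) (hq0 z)
    · rw [Fintype.sum_prod_type]
      simp only [← hqA, hqsum, zero_lt_one]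
    · rintro ⟨z, x⟩ h
      have hx : 0 < P1 x := pos_of_mul_pos_left h (hA0 z x)
      refine mul_pos (h.trans_le ?_) hx
      rw [hqA]
      exact single_le_sum (f := fun x => P1 x * ∑ x2, P2 x2 * W z x x2)
        (fun x _ => mul_nonneg (hP10 x) (hA0 z x)) (mem_univ x)
  have e2 : Real.exp (s * renyiDiv (1 + s)
      (fun p : Z × X2 => P2 p.2 * ∑ x1, P1 x1 * W p.1 x1 p.2)
      (fun p : Z × X2 => q p.1 * P2 p.2)) =
      ∑ z, (∑ x2, P2 x2 * (∑ x1, P1 x1 * W z x1 x2) ^ (1 + s)) * q z ^ (-s) := by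
    rw [exp_mul_renyiDiv_one_add hs (fun p => mul_nonneg (hP20 _) (hB0 _ _)) ?_
      (fun p => mul_nonneg (hq0 _) (hP20 _)) ?_, Fintype.sum_prod_type]
    · refine sum_congr rfl fun z _ => ?_
      rw [sum_mul]
      exact sum_congr rfl fun x _ =>
        Real.mul_rpow_one_add_mul_mul_rpow_neg hs (hP20 x) (hB0 z x) (hq0 z)
    · rw [Fintype.sum_prod_type]
      simp only [← hqB, hqsum, zero_lt_one]
    · rintro ⟨z, x⟩ h
      have hx : 0 < P2 x := pos_of_mul_pos_left h (hB0 z x)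
      refine mul_pos (h.trans_le ?_) hx
      rw [hqB]
      exact single_le_sum (f := fun x => P2 x * ∑ x1, P1 x1 * W z x1 x)
        (fun x _ => mul_nonneg (hP20 x) (hB0 z x)) (mem_univ x)
  have e12 : Real.exp (s * renyiDiv (1 + s)
      (fun p : Z × (X1 × X2) => P1 p.2.1 * P2 p.2.2 * W p.1 p.2.1 p.2.2)
      (fun p : Z × (X1 × X2) => q p.1 * (P1 p.2.1 * P2 p.2.2))) =
      ∑ z, (∑ x1, ∑ x2, P1 x1 * P2 x2 * W z x1 x2 ^ (1 + s)) * q z ^ (-s) := by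
    rw [exp_mul_renyiDiv_one_add hs (fun p => hterm0 _ _ _) ?_
      (fun p => mul_nonneg (hq0 _) (mul_nonneg (hP10 _) (hP20 _))) ?_, Fintype.sum_prod_type]
    · refine sum_congr rfl fun z _ => ?_
      rw [Fintype.sum_prod_type, sum_mul]
      refine sum_congr rfl fun x _ => ?_
      rw [sum_mul]
      exact sum_congr rfl fun u _ => Real.mul_rpow_one_add_mul_mul_rpow_neg hs
        (mul_nonneg (hP10 x) (hP20 u)) (hW0 z x u) (hq0 z)
    · simp only [Fintype.sum_prod_type]
      exact hqsum.symm ▸ zero_lt_one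
    · rintro ⟨z, x, u⟩ h
      have hxu : 0 < P1 x * P2 u := pos_of_mul_pos_left h (hW0 z x u)
      have hx := pos_of_mul_pos_left hxu (hP20 u)
      have hu := pos_of_mul_pos_right hxu (hP10 x)
      exact mul_pos (hqpos z x u hx hu (pos_of_mul_pos_right h hxu.le)) hxu
  rw [e1, e2, e12]
  -- `log t ≤ t - 1` for each codebook of positive probability
  have hlog (c1 c2) : s * (w c1 c2 * renyiDiv (1 + s) (T c1 c2) q) ≤
      w c1 c2 * (∑ z, T c1 c2 z ^ (1 + s) * q z ^ (-s)) - w c1 c2 := by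
    rcases (hw0 c1 c2).eq_or_lt with h | h
    · simp [← h]
    have hc1 (j) : 0 < P1 (c1 j) := (hP10 _).lt_of_ne' fun h0 => h.ne' <| by
      simp only [hw]
      rw [prod_eq_zero (mem_univ j) h0, zero_mul]
    have hc2 (j) : 0 < P2 (c2 j) := (hP20 _).lt_of_ne' fun h0 => h.ne' <| by
      simp only [hw]
      rw [prod_eq_zero (mem_univ j) h0, mul_zero]
    have hpos := sum_rpow_mul_rpow_pos (1 + s) (-s) (hT0 c1 c2) (by simp [hTsum]) hq0 fun z hz => by
      have hz' := pos_of_mul_pos_right hz (by positivity)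
      obtain ⟨j1, -, h1⟩ := exists_lt_of_sum_lt (s := univ) (f := fun _ : Fin L1 => (0 : ℝ))
        (by simpa using hz')
      obtain ⟨j2, -, h2⟩ := exists_lt_of_sum_lt (s := univ) (f := fun _ : Fin L2 => (0 : ℝ))
        (by simpa using h1)
      exact hqpos z _ _ (hc1 j1) (hc2 j2) h2
    rw [mul_left_comm, mul_renyiDiv_one_add hs (hT0 c1 c2)]
    calc _ ≤ w c1 c2 * (∑ z, T c1 c2 z ^ (1 + s) * q z ^ (-s) - 1) := by
          gcongr
          exact Real.log_le_sub_one_of_pos hpos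
      _ = _ := by ring
  have hz (z) : (∑ c1, ∑ c2, w c1 c2 * T c1 c2 z ^ (1 + s)) * q z ^ (-s) ≤
      (((L1 : ℝ) * L2) ^ (-s) * ∑ x1, ∑ x2, P1 x1 * P2 x2 * W z x1 x2 ^ (1 + s) +
      (L1 : ℝ) ^ (-s) * ∑ x1, P1 x1 * (∑ x2, P2 x2 * W z x1 x2) ^ (1 + s) +
      (L2 : ℝ) ^ (-s) * ∑ x2, P2 x2 * (∑ x1, P1 x1 * W z x1 x2) ^ (1 + s)) * q z ^ (-s) +
      q z := by
    rcases (hq0 z).eq_or_lt with h | h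
    · simp [← h, Real.zero_rpow (neg_ne_zero.2 hs.ne')]
    · have := mul_le_mul_of_nonneg_right (sum_prod_mul_rpow_one_add_le_add hP10 hP11 hP20 hP21
        hL1 hL2 (hW0 z) hs0 hs1 (q := q z) rfl h) (Real.rpow_nonneg h.le (-s))
      refine this.trans_eq ?_
      rw [add_mul _ (q z ^ (1 + s)), ← Real.rpow_add h, add_neg_cancel_right, Real.rpow_one]
  have hsum : ∑ c1, ∑ c2, w c1 c2 * ∑ z, T c1 c2 z ^ (1 + s) * q z ^ (-s) =
      ∑ z, (∑ c1, ∑ c2, w c1 c2 * T c1 c2 z ^ (1 + s)) * q z ^ (-s) := by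
    simp_rw [mul_sum, sum_mul]
    rw [sum_congr rfl fun _ _ => sum_comm, sum_comm]
    simp_rw [mul_assoc]
  calc _ ≤ ∑ c1, ∑ c2, (w c1 c2 * (∑ z, T c1 c2 z ^ (1 + s) * q z ^ (-s)) - w c1 c2) := by
        rw [mul_sum]
        refine sum_le_sum fun c1 _ => ?_
        rw [mul_sum]
        exact sum_le_sum fun c2 _ => hlog c1 c2
    _ = ∑ z, (∑ c1, ∑ c2, w c1 c2 * T c1 c2 z ^ (1 + s)) * q z ^ (-s) - 1 := by
        simp_rw [sum_sub_distrib, hwsum, hsum]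
    _ ≤ _ := by
        rw [sub_le_iff_le_add]
        refine (sum_le_sum fun z _ => hz z).trans_eq ?_
        rw [sum_add_distrib, hqsum]
        simp_rw [add_mul, sum_add_distrib, mul_assoc, ← mul_sum]
        ring
end

section
/- Reliability lemma: Let 𝒳1, 𝒳2, 𝒴 be finite sets, W(y|x1,x2) a channel (a PMF on 𝒴 for each (x1,x2)), P_1, P_2 PMFs on 𝒳1, 𝒳2, and N ≥ 1 an integer. Let the codebook 𝒞′ consist of X_{2,1},…,X_{2,N} drawn i.i.d. from P_2 and X_1 drawn from P_1, all mutually independent; let the message J be uniform on {1,…,N} independent of 𝒞′, and let Y be drawn from W(·|X_1, X_{2,J}). Define e_{𝒞′} := min_{ψ : 𝒴×𝒳1 → {1,…,N}} Pr[ψ(Y, X_1) ≠ J | 𝒞′] (the error probability of the best decoder given the codebook, achieved by maximum-likelihood decoding). Then for every s ∈ [0,1]: E_{𝒞′}[ e_{𝒞′} ] ≤ N^s · Σ_{x_1} P_1(x_1) Σ_{y} ( Σ_{x_2} P_2(x_2) · W(y|x_1,x_2)^{1/(1+s)} )^{1+s}, i.e., E_{𝒞′}[e_{𝒞′}] ≤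 N^s · e^{−s·I↓_{1/(1+s)}(Y;X_2|X_1)}. -/
open Finset

/-- Under a product distribution, one coordinate can be separated from the remaining ones. -/
theorem sum_prod_mul_insertNth {α : Type*} [Fintype α] {n : ℕ} (P : α → ℝ) (i : Fin (n + 1))
    (F : α → (Fin n → α) → ℝ) :
    ∑ c : Fin (n + 1) → α, (∏ j, P (c j)) * F (c i) (fun k => c (i.succAbove k)) =
      ∑ x, ∑ d : Fin n → α, P x * (∏ k, P (d k)) * F x d := by
  rw [← (Fin.insertNthEquiv (fun _ => α) i).sum_comp, Fintype.sum_prod_type]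
  refine sum_congr rfl fun x _ => sum_congr rfl fun d _ => ?_
  simp [Fin.prod_univ_succAbove _ i]

theorem sum_prod_eq_one {α : Type*} [Fintype α] (P : α → ℝ) (hP : ∑ x, P x = 1) (n : ℕ) :
    ∑ d : Fin n → α, ∏ k, P (d k) = 1 := by
  rw [← Fintype.sum_pow, hP, one_pow]

/-- The expectation of a function of a single coordinate under a product distribution. -/
theorem sum_prod_mul_apply_s3 {α : Type*} [Fintype α] (P : α → ℝ) (hP : ∑ x, P x = 1) {n : ℕ}
    (f : α → ℝ) (k : Fin n) :
    ∑ d : Fin n → α, (∏ j, P (d j)) * f (d k) = ∑ x, P x * f x := by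
  cases n with
  | zero => exact k.elim0
  | succ n =>
    rw [sum_prod_mul_insertNth P k (fun x _ => f x)]
    refine sum_congr rfl fun x _ => ?_
    rw [← sum_mul, ← mul_sum, sum_prod_eq_one P hP, mul_one]

/-- Jensen's inequality for the `s`-th power of an i.i.d. sum, `0 ≤ s ≤ 1`. -/
theorem sum_prod_mul_rpow_sum_le {α : Type*} [Fintype α] (P : α → ℝ) (hP0 : ∀ x, 0 ≤ P x)
    (hP : ∑ x, P x = 1) (n : ℕ) (f : α → ℝ) (hf : ∀ x, 0 ≤ f x) {s : ℝ} (hs0 : 0 ≤ s)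
    (hs1 : s ≤ 1) :
    ∑ d : Fin n → α, (∏ j, P (d j)) * (∑ k, f (d k)) ^ s ≤ (n * ∑ x, P x * f x) ^ s := by
  have h := (Real.concaveOn_rpow hs0 hs1).le_map_sum (t := (univ : Finset (Fin n → α)))
    (w := fun d => ∏ j, P (d j)) (p := fun d => ∑ k, f (d k))
    (fun d _ => prod_nonneg fun j _ => hP0 _) (sum_prod_eq_one P hP n)
    (fun d _ => sum_nonneg fun k _ => hf _)
  simp only [smul_eq_mul] at h
  refine h.trans_eq ?_
  congr 1
  simp only [mul_sum]
  rw [sum_comm]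
  simp only [sum_prod_mul_apply_s3 P hP, sum_const, card_univ, Fintype.card_fin, nsmul_eq_mul, mul_sum]

/-- Gallager's pointwise bound: if some competitor `b k` is at least `a`, then `a` is dominated
by `a ^ (1 / (1 + s)) * (∑ k, b k ^ (1 / (1 + s))) ^ s`. -/
theorem le_rpow_mul_rpow_sum {ι : Type*} [Fintype ι] {a : ℝ} (ha : 0 ≤ a) {b : ι → ℝ}
    (hb : ∀ k, 0 ≤ b k) {s : ℝ} (hs : 0 ≤ s) {k : ι} (hk : a ≤ b k) :
    a ≤ a ^ (1 / (1 + s)) * (∑ k, b k ^ (1 / (1 + s))) ^ s := by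
  have h1 : 0 < 1 + s := by linarith
  have hle : a ^ (1 / (1 + s)) ≤ ∑ k, b k ^ (1 / (1 + s)) :=
    (Real.rpow_le_rpow ha hk (by positivity)).trans
      (single_le_sum (f := fun k => b k ^ (1 / (1 + s)))
        (fun k _ => Real.rpow_nonneg (hb k) _) (mem_univ k))
  calc a = a ^ (1 / (1 + s)) * (a ^ (1 / (1 + s))) ^ s := by
        rw [← Real.rpow_one_add' (Real.rpow_nonneg ha _) h1.ne', ← Real.rpow_mul ha,
          one_div_mul_cancel h1.ne', Real.rpow_one]
    _ ≤ _ := by gcongr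

/-- The expected Gallager bound for one transmitted codeword against `n` independent ones. -/
theorem sum_prod_mul_gallager_le {α : Type*} [Fintype α] (P : α → ℝ) (hP0 : ∀ x, 0 ≤ P x)
    (hP : ∑ x, P x = 1) (n : ℕ) (i : Fin (n + 1)) (f : α → ℝ) (hf : ∀ x, 0 ≤ f x) {s : ℝ}
    (hs0 : 0 ≤ s) (hs1 : s ≤ 1) :
    ∑ c : Fin (n + 1) → α, (∏ j, P (c j)) * (f (c i) * (∑ k, f (c (i.succAbove k))) ^ s) ≤
      ((n + 1 : ℕ) : ℝ) ^ s * (∑ x, P x * f x) ^ (1 + s) := by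
  have hm : 0 ≤ ∑ x, P x * f x := sum_nonneg fun x _ => mul_nonneg (hP0 x) (hf x)
  rw [sum_prod_mul_insertNth P i (fun x d => f x * (∑ k, f (d k)) ^ s)]
  calc ∑ x, ∑ d : Fin n → α, P x * (∏ k, P (d k)) * (f x * (∑ k, f (d k)) ^ s)
      = (∑ x, P x * f x) * ∑ d : Fin n → α, (∏ k, P (d k)) * (∑ k, f (d k)) ^ s := by
        rw [sum_mul_sum]
        exact sum_congr rfl fun x _ => sum_congr rfl fun d _ => by ring
    _ ≤ (∑ x, P x * f x) * (((n + 1 : ℕ) : ℝ) * ∑ x, P x * f x) ^ s := by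
        refine mul_le_mul_of_nonneg_left
          ((sum_prod_mul_rpow_sum_le P hP0 hP n f hf hs0 hs1).trans ?_) hm
        gcongr
        simp
    _ = _ := by
        rw [Real.mul_rpow (by positivity) hm, Real.rpow_one_add' hm (by linarith)]
        ring

/-- The optimal decoder's error probability is at most the Gallager sum. -/
theorem iInf_decoder_error_le {X Y : Type*} [Fintype X] [Fintype Y] {n : ℕ} (x : X)
    (a : Y → Fin (n + 1) → ℝ) (ha : ∀ y j, 0 ≤ a y j) {s : ℝ} (hs : 0 ≤ s) :
    (⨅ ψ : Y × X → Fin (n + 1), (1 / ((n + 1 : ℕ) : ℝ)) *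
        ∑ j, ∑ y, a y j * (if ψ (y, x) = j then 0 else 1)) ≤
      (1 / ((n + 1 : ℕ) : ℝ)) * ∑ j, ∑ y, a y j ^ (1 / (1 + s)) *
        (∑ k, a y (j.succAbove k) ^ (1 / (1 + s))) ^ s := by
  choose g hg using fun y => Finite.exists_max (a y)
  refine (ciInf_le (Set.finite_range _).bddBelow (fun p : Y × X => g p.1)).trans ?_
  refine mul_le_mul_of_nonneg_left (sum_le_sum fun j _ => sum_le_sum fun y _ => ?_)
    (by positivity)
  split_ifs with h
  · rw [mul_zero]
    exact mul_nonneg (Real.rpow_nonneg (ha y j) _)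
      (Real.rpow_nonneg (sum_nonneg fun k _ => Real.rpow_nonneg (ha y _) _) _)
  · obtain ⟨k, hk⟩ := Fin.exists_succAbove_eq h
    rw [mul_one]
    exact le_rpow_mul_rpow_sum (ha y j) (b := fun k => a y (j.succAbove k))
      (fun k => ha y _) hs (k := k) (by simpa only [hk] using hg y j)

/-- Reliability lemma (Gallager-type bound for a MAC with one known input): the expected
error probability of the best decoder over a random codebook of `N` i.i.d. codewords from
`P2`, with side information `X1 ~ P1` known at the receiver, is bounded as
`E_{𝒞′}[e_{𝒞′}] ≤ N^s · Σ_{x1} P1(x1) Σ_y (Σ_{x2} P2(x2) W(y|x1,x2)^{1/(1+s)})^{1+s}`,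
i.e. `E_{𝒞′}[e_{𝒞′}] ≤ N^s · e^{−s·I↓_{1/(1+s)}(Y;X2|X1)}`, for every `s ∈ [0,1]`. -/
theorem reliability_MAC {X1 X2 Y : Type*} [Fintype X1] [Fintype X2] [Fintype Y]
    [DecidableEq X1] [DecidableEq Y]
    (W : Y → X1 → X2 → ℝ) (hW0 : ∀ y x1 x2, 0 ≤ W y x1 x2)
    (hW1 : ∀ x1 x2, ∑ y, W y x1 x2 = 1)
    (P1 : X1 → ℝ) (hP10 : ∀ x, 0 ≤ P1 x) (hP11 : ∑ x, P1 x = 1)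
    (P2 : X2 → ℝ) (hP20 : ∀ x, 0 ≤ P2 x) (hP21 : ∑ x, P2 x = 1)
    (N : ℕ) (hN : 1 ≤ N)
    (s : ℝ) (hs : s ∈ Set.Icc (0 : ℝ) 1) :
    (∑ x1 : X1, ∑ c : Fin N → X2,
      (P1 x1 * ∏ j, P2 (c j)) *
        ⨅ ψ : Y × X1 → Fin N,
          (1 / (N : ℝ)) * ∑ j, ∑ y, W y x1 (c j) * (if ψ (y, x1) = j then 0 else 1)) ≤
      (N : ℝ) ^ s *
        ∑ x1, P1 x1 * ∑ y, (∑ x2, P2 x2 * W y x1 x2 ^ (1 / (1 + s))) ^ (1 + s) := by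
  obtain ⟨n, rfl⟩ : ∃ n, N = n + 1 := ⟨N - 1, by omega⟩
  obtain ⟨hs0, hs1⟩ := hs
  rw [mul_sum]
  refine sum_le_sum fun x1 _ => ?_
  calc ∑ c : Fin (n + 1) → X2, (P1 x1 * ∏ j, P2 (c j)) *
        ⨅ ψ : Y × X1 → Fin (n + 1), (1 / ((n + 1 : ℕ) : ℝ)) *
          ∑ j, ∑ y, W y x1 (c j) * (if ψ (y, x1) = j then 0 else 1)
      ≤ ∑ c : Fin (n + 1) → X2, (P1 x1 * ∏ j, P2 (c j)) * ((1 / ((n + 1 : ℕ) : ℝ)) *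
          ∑ j, ∑ y, W y x1 (c j) ^ (1 / (1 + s)) *
            (∑ k, W y x1 (c (j.succAbove k)) ^ (1 / (1 + s))) ^ s) :=
        sum_le_sum fun c _ => mul_le_mul_of_nonneg_left
          (iInf_decoder_error_le x1 (fun y j => W y x1 (c j)) (fun y j => hW0 _ _ _) hs0)
          (mul_nonneg (hP10 x1) (prod_nonneg fun j _ => hP20 _))
    _ = P1 x1 * ((1 / ((n + 1 : ℕ) : ℝ)) * ∑ j : Fin (n + 1), ∑ y,
          ∑ c : Fin (n + 1) → X2, (∏ j, P2 (c j)) * (W y x1 (c j) ^ (1 / (1 + s)) *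
            (∑ k, W y x1 (c (j.succAbove k)) ^ (1 / (1 + s))) ^ s)) := by
        simp_rw [sum_comm (s := (univ : Finset Y)) (t := (univ : Finset (Fin (n + 1) → X2)))]
        rw [sum_comm]
        simp_rw [← mul_sum]
        rw [mul_sum, mul_sum]
        exact sum_congr rfl fun c _ => by ring
    _ ≤ P1 x1 * ((1 / ((n + 1 : ℕ) : ℝ)) * ∑ _j : Fin (n + 1), ∑ y, ((n + 1 : ℕ) : ℝ) ^ s *
          (∑ x2, P2 x2 * W y x1 x2 ^ (1 / (1 + s))) ^ (1 + s)) := by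
        refine mul_le_mul_of_nonneg_left (mul_le_mul_of_nonneg_left
          (sum_le_sum fun j _ => sum_le_sum fun y _ => ?_) (by positivity)) (hP10 x1)
        exact sum_prod_mul_gallager_le P2 hP20 hP21 n j (fun x2 => W y x1 x2 ^ (1 / (1 + s)))
          (fun x2 => Real.rpow_nonneg (hW0 _ _ _) _) hs0 hs1
    _ = _ := by
        rw [sum_const, card_univ, Fintype.card_fin, nsmul_eq_mul, ← mul_assoc (1 / _),
          one_div_mul_cancel (by positivity), one_mul, ← mul_sum]
        ring
end
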